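/- arXiv:math/9910176 — 2 statements merged into one kernel-verified Lean document; each statement's English description precedes it below -/
import Mathlib

section
/- Let a = 1/20, b = 19/20 and G(u,q,d,α) = (dq − u²)(b + a·u^{5/2})/u^{5/2} + q(u² − dq)/u² + α for u > 0. Suppose u > 0 and α ≠ 0 satisfy 16αu³a − b(−25b + 24α√u) = 0, and set q = 5b(−5b + 4α√u)/(16αu) and d = −16αu³/(25b²). Then at this point G = 0, ∂G/∂u = 0, ∂G/∂q = 0, and the determinant of the Hessian of G with respect to (u,q) equals −96α²/(25b²u) < 0; hence every such point is a transcritical (and not an isola) bifurcation point of P_LH, and moreover ∂²G/∂u² = (25b²/α − 20b√u − 2αu)/(2u³). -/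
/-- Numerical constant `a = 0.05` of the L–H transition problem. -/
noncomputable def aC : ℝ := 1/20
/-- Numerical constant `b = 0.95` of the L–H transition problem. -/
noncomputable def bC : ℝ := 19/20

/-- The universal unfolding `P_LH` of the L–H plasma confinement transition problem:
`G(u,q,d,α) = (dq − u²)(b + a·u^{5/2})/u^{5/2} + q(u² − dq)/u² + α`. -/
noncomputable def G (u q d al : ℝ) : ℝ :=
  (d*q - u^2) * (bC + aC * u ^ ((5:ℝ)/2)) / u ^ ((5:ℝ)/2) + q * (u^2 - d*q) / u^2 + al

/-- `∂G/∂u` -/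
noncomputable def Gu (u q d al : ℝ) : ℝ := deriv (fun t => G t q d al) u
/-- `∂G/∂q` -/
noncomputable def Gq (u q d al : ℝ) : ℝ := deriv (fun t => G u t d al) q
/-- `∂²G/∂u²` -/
noncomputable def Guu (u q d al : ℝ) : ℝ := deriv (fun t => Gu t q d al) u
/-- `∂²G/∂u∂q` -/
noncomputable def Guq (u q d al : ℝ) : ℝ := deriv (fun t => Gu u t d al) q
/-- `∂²G/∂q∂u` -/
noncomputable def Gqu (u q d al : ℝ) : ℝ := deriv (fun t => Gq t q d al) u
/-- `∂²G/∂q²` -/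
noncomputable def Gqq (u q d al : ℝ) : ℝ := deriv (fun t => Gq u t d al) q
/-- `∂³G/∂u³` -/
noncomputable def Guuu (u q d al : ℝ) : ℝ := deriv (fun t => Guu t q d al) u
/-- Determinant of the Hessian of `G` with respect to `(u,q)`. -/
noncomputable def detH (u q d al : ℝ) : ℝ :=
  Guu u q d al * Gqq u q d al - Guq u q d al * Gqu u q d al

lemma bC_pos : 0 < bC := by norm_num [bC]

lemma rpow_five_halves {u : ℝ} (hu : 0 < u) : u ^ ((5:ℝ)/2) = Real.sqrt u ^ 5 := by
  rw [Real.sqrt_eq_rpow, ← Real.rpow_natCast, ← Real.rpow_mul hu.le]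
  norm_num

lemma G_eq_sqrt {u : ℝ} (hu : 0 < u) (q d al : ℝ) :
    G u q d al = (d*q - u^2) * (bC / Real.sqrt u ^ 5 + aC) + q * (u^2 - d*q) / u^2 + al := by
  have hs := Real.sqrt_pos.2 hu
  rw [G, rpow_five_halves hu]
  field_simp

lemma Gu_eq {u : ℝ} (hu : 0 < u) (q d al : ℝ) :
    Gu u q d al = -2*u * (bC / Real.sqrt u ^ 5 + aC)
      - 5/2 * (d*q - u^2) * bC / Real.sqrt u ^ 7 + 2*d*q^2 / u^3 := by
  have hs := Real.sqrt_pos.2 hu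
  have hG : (fun t => G t q d al) =ᶠ[nhds u] fun t =>
      (d*q - t^2) * (bC / Real.sqrt t ^ 5 + aC) + q * (t^2 - d*q) / t^2 + al := by
    filter_upwards [lt_mem_nhds hu] with t ht using G_eq_sqrt ht q d al
  have hsq := Real.hasDerivAt_sqrt hu.ne'
  have h2 := hasDerivAt_pow 2 u
  have h := ((((h2.const_sub (d*q)).mul
    (((hasDerivAt_const u bC).div (hsq.pow 5) (pow_pos hs 5).ne').add_const aC)).add
    (((h2.sub_const (d*q)).const_mul q).div h2 (pow_pos hu 2).ne')).add_const al)
  rw [Gu, hG.deriv_eq]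
  refine h.deriv.trans ?_
  simp only [Pi.pow_apply, Pi.div_apply]
  obtain ⟨s, hs', rfl⟩ : ∃ s, 0 < s ∧ u = s^2 := ⟨_, hs, (Real.sq_sqrt hu.le).symm⟩
  rw [Real.sqrt_sq hs'.le]
  field_simp
  ring

lemma Gq_eq {u : ℝ} (hu : 0 < u) (q d al : ℝ) :
    Gq u q d al = d * (bC / Real.sqrt u ^ 5 + aC) + 1 - 2*d*q / u^2 := by
  have hG : (fun t => G u t d al) = fun t =>
      (d*t - u^2) * (bC / Real.sqrt u ^ 5 + aC) + t * (u^2 - d*t) / u^2 + al :=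
    funext fun t => G_eq_sqrt hu t d al
  have hid := hasDerivAt_id q
  have h := ((((hid.const_mul d).sub_const (u^2)).mul_const (bC / Real.sqrt u ^ 5 + aC)).add
    ((hid.mul ((hid.const_mul d).const_sub (u^2))).div_const (u^2))).add_const al
  rw [Gq, hG]
  refine h.deriv.trans ?_
  simp only [id]
  field_simp
  ring

lemma Guu_eq {u : ℝ} (hu : 0 < u) (q d al : ℝ) :
    Guu u q d al = -2*aC - 3/4 * bC / Real.sqrt u ^ 5
      + 35/4 * d*q*bC / Real.sqrt u ^ 9 - 6*d*q^2 / u^4 := by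
  have hs := Real.sqrt_pos.2 hu
  have hG : (fun t => Gu t q d al) =ᶠ[nhds u] fun t =>
      -2*t * (bC / Real.sqrt t ^ 5 + aC)
      - 5/2 * (d*q - t^2) * bC / Real.sqrt t ^ 7 + 2*d*q^2 / t^3 := by
    filter_upwards [lt_mem_nhds hu] with t ht using Gu_eq ht q d al
  have hsq := Real.hasDerivAt_sqrt hu.ne'
  have h2 := hasDerivAt_pow 2 u
  have h3 := hasDerivAt_pow 3 u
  have h := ((((hasDerivAt_id u).const_mul (-2)).mul
    (((hasDerivAt_const u bC).div (hsq.pow 5) (pow_pos hs 5).ne').add_const aC)).sub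
    ((((h2.const_sub (d*q)).const_mul (5/2)).mul_const bC).div (hsq.pow 7) (pow_pos hs 7).ne')).add
    ((hasDerivAt_const u (2*d*q^2)).div h3 (pow_pos hu 3).ne')
  rw [Guu, hG.deriv_eq]
  refine h.deriv.trans ?_
  simp only [Pi.pow_apply, Pi.div_apply, id]
  obtain ⟨s, hs', rfl⟩ : ∃ s, 0 < s ∧ u = s^2 := ⟨_, hs, (Real.sq_sqrt hu.le).symm⟩
  rw [Real.sqrt_sq hs'.le]
  field_simp
  ring

lemma Guq_eq {u : ℝ} (hu : 0 < u) (q d al : ℝ) :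
    Guq u q d al = -(5/2) * d * bC / Real.sqrt u ^ 7 + 4*d*q / u^3 := by
  have hG : (fun t => Gu u t d al) = fun t =>
      -2*u * (bC / Real.sqrt u ^ 5 + aC)
      - 5/2 * (d*t - u^2) * bC / Real.sqrt u ^ 7 + 2*d*t^2 / u^3 :=
    funext fun t => Gu_eq hu t d al
  have h := (((((((hasDerivAt_id q).const_mul d).sub_const (u^2)).const_mul (5/2)).mul_const
    bC).div_const (Real.sqrt u ^ 7)).const_sub (-2*u * (bC / Real.sqrt u ^ 5 + aC))).add
    (((hasDerivAt_pow 2 q).const_mul (2*d)).div_const (u^3))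
  rw [Guq, hG]
  refine h.deriv.trans ?_
  push_cast
  ring

lemma Gqu_eq {u : ℝ} (hu : 0 < u) (q d al : ℝ) :
    Gqu u q d al = -(5/2) * d * bC / Real.sqrt u ^ 7 + 4*d*q / u^3 := by
  have hs := Real.sqrt_pos.2 hu
  have hG : (fun t => Gq t q d al) =ᶠ[nhds u] fun t =>
      d * (bC / Real.sqrt t ^ 5 + aC) + 1 - 2*d*q / t^2 := by
    filter_upwards [lt_mem_nhds hu] with t ht using Gq_eq ht q d al
  have hsq := Real.hasDerivAt_sqrt hu.ne'
  have h := (((((hasDerivAt_const u bC).div (hsq.pow 5) (pow_pos hs 5).ne').add_const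
    aC).const_mul d).add_const 1).sub
    ((hasDerivAt_const u (2*d*q)).div (hasDerivAt_pow 2 u) (pow_pos hu 2).ne')
  rw [Gqu, hG.deriv_eq]
  refine h.deriv.trans ?_
  simp only [Pi.pow_apply]
  obtain ⟨s, hs', rfl⟩ : ∃ s, 0 < s ∧ u = s^2 := ⟨_, hs, (Real.sq_sqrt hu.le).symm⟩
  rw [Real.sqrt_sq hs'.le]
  field_simp
  ring

lemma Gqq_eq {u : ℝ} (hu : 0 < u) (q d al : ℝ) : Gqq u q d al = -2*d / u^2 := by
  have hG : (fun t => Gq u t d al) = fun t =>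
      d * (bC / Real.sqrt u ^ 5 + aC) + 1 - 2*d*t / u^2 :=
    funext fun t => Gq_eq hu t d al
  have h := (((hasDerivAt_id q).const_mul (2*d)).div_const (u^2)).const_sub
    (d * (bC / Real.sqrt u ^ 5 + aC) + 1)
  rw [Gqq, hG]
  refine h.deriv.trans ?_
  ring


/-- On the locus `16αu³a − b(−25b + 24α√u) = 0` with the stated `q` and `d`, the L–H
problem has `G = Gu = Gq = 0` and `det d²G = −96α²/(25b²u) < 0`; hence every such point
is a transcritical (and not an isola) bifurcation point, and `Guu` has the stated form. -/
theorem LH_transcritical_locus (u al : ℝ) (hu : 0 < u) (hal : al ≠ 0)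
    (hroot : 16*al*u^3*aC - bC*(-(25*bC) + 24*al*Real.sqrt u) = 0)
    (q d : ℝ)
    (hq : q = 5*bC*(-(5*bC) + 4*al*Real.sqrt u) / (16*al*u))
    (hd : d = -(16*al*u^3) / (25*bC^2)) :
    G u q d al = 0 ∧ Gu u q d al = 0 ∧ Gq u q d al = 0 ∧
    detH u q d al = -(96*al^2) / (25*bC^2*u) ∧
    detH u q d al < 0 ∧ ¬ detH u q d al > 0 ∧
    Guu u q d al = (25*bC^2/al - 20*bC*Real.sqrt u - 2*al*u) / (2*u^3) := by
  have hb := bC_pos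
  obtain ⟨s, hs, rfl⟩ : ∃ s, 0 < s ∧ u = s^2 :=
    ⟨_, Real.sqrt_pos.2 hu, (Real.sq_sqrt hu.le).symm⟩
  have hsqrt : Real.sqrt (s^2) = s := Real.sqrt_sq hs.le
  rw [hsqrt] at hroot hq
  have ha : aC = (24*al*bC*s - 25*bC^2) / (16*al*s^6) := by
    field_simp
    linear_combination hroot
  have hdet : detH (s^2) q d al = -(96*al^2) / (25*bC^2*s^2) := by
    rw [detH, Guu_eq hu, Gqq_eq hu, Guq_eq hu, Gqu_eq hu, hsqrt, ha, hq, hd]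
    field_simp
    ring
  have hneg : detH (s^2) q d al < 0 := by
    rw [hdet, neg_div]
    exact neg_neg_of_pos (by positivity)
  refine ⟨?_, ?_, ?_, hdet, hneg, hneg.not_gt, ?_⟩
  · rw [G_eq_sqrt hu, hsqrt, ha, hq, hd]
    field_simp
    ring
  · rw [Gu_eq hu, hsqrt, ha, hq, hd]
    field_simp
    ring
  · rw [Gq_eq hu, hsqrt, ha, hq, hd]
    field_simp
    ring
  · rw [Guu_eq hu, hsqrt, ha, hq, hd]
    field_simp
    ring
end

section
/- Let a = 1/20, b = 19/20 and G(u,q,d,α) = (dq − u²)(b + a·u^{5/2})/u^{5/2} + q(u² − dq)/u² + α for u > 0. Set u* = b^{2/5}/(2·2^{1/5} a^{2/5})^{... } given by u* = b^{2/5}/(2·2^{1/5}·a^{2/5}), q* = 5b/(8√u*), d* = 8u*^{5/2}/(25b), α* = 2b/(5√u*). Then at the point (u*,q*,d*,α*) the E₂ conditions hold: G = 0, ∂G/∂u = 0, ∂²G/∂u∂q = 0, ∂²G/∂u² = 0, and moreover ∂G/∂q = 24/25 > 0 and ∂³G/∂u³ = −3b/u*^{7/2} < 0. -/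
/-- Derivative of a linear combination of four real powers and a constant. -/
theorem hasDerivAt_four_rpow (A B C D E p q r s : ℝ) {u : ℝ} (hu : 0 < u) :
    HasDerivAt (fun t : ℝ => A * t ^ p + B * t ^ q + C * t ^ r + D * t ^ s + E)
      (A * p * u ^ (p - 1) + B * q * u ^ (q - 1) + C * r * u ^ (r - 1) + D * s * u ^ (s - 1))
      u := by
  have h (K x : ℝ) : HasDerivAt (fun t : ℝ => K * t ^ x) (K * x * u ^ (x - 1)) u := by
    simpa only [mul_assoc] using (Real.hasDerivAt_rpow_const (p := x) (Or.inl hu.ne')).const_mul K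
  exact ((((h A p).add (h B q)).add (h C r)).add (h D s)).add_const E

theorem deriv_eq_of_eqOn_pos {f g : ℝ → ℝ} {g' u : ℝ} (hu : 0 < u)
    (hfg : ∀ t, 0 < t → f t = g t) (hg : HasDerivAt g g' u) : deriv f u = g' :=
  (hg.congr_of_eventuallyEq ((eventually_gt_nhds hu).mono hfg)).deriv

theorem sq_rpow_natCast_div_two {s : ℝ} (hs : 0 < s) (n : ℕ) :
    (s ^ 2) ^ ((n : ℝ) / 2) = s ^ n := by
  rw [← Real.rpow_natCast, ← Real.rpow_mul hs.le, ← Real.rpow_natCast]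
  congr 1
  push_cast
  ring

theorem sq_rpow_neg_natCast_div_two {s : ℝ} (hs : 0 < s) (n : ℕ) :
    (s ^ 2) ^ (-(n : ℝ) / 2) = (s ^ n)⁻¹ := by
  rw [neg_div, Real.rpow_neg (sq_nonneg s), sq_rpow_natCast_div_two hs]

theorem sq_rpow_neg_natCast {s : ℝ} (n : ℕ) :
    (s ^ 2) ^ (-(n : ℝ)) = (s ^ (2 * n))⁻¹ := by
  rw [Real.rpow_neg (sq_nonneg s), Real.rpow_natCast, pow_mul]

theorem G_eq_rpow {u : ℝ} (hu : 0 < u) (q d al : ℝ) :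
    G u q d al = d * q * bC * u ^ (-5 / 2 : ℝ) + -bC * u ^ (-1 / 2 : ℝ) + -aC * u ^ (2 : ℝ)
      + -(d * q ^ 2) * u ^ (-2 : ℝ) + (aC * d * q + q + al) := by
  obtain ⟨s, hs, rfl⟩ : ∃ s : ℝ, 0 < s ∧ u = s ^ 2 :=
    ⟨√u, Real.sqrt_pos.2 hu, (Real.sq_sqrt hu.le).symm⟩
  have h1 : (s ^ 2) ^ (-1 / 2 : ℝ) = s⁻¹ := by
    simpa using sq_rpow_neg_natCast_div_two hs 1
  have h5 : (s ^ 2) ^ (-5 / 2 : ℝ) = (s ^ 5)⁻¹ := mod_cast sq_rpow_neg_natCast_div_two hs 5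
  have h5' : (s ^ 2) ^ (5 / 2 : ℝ) = s ^ 5 := mod_cast sq_rpow_natCast_div_two hs 5
  have h4 : (s ^ 2) ^ (-2 : ℝ) = (s ^ 4)⁻¹ := mod_cast sq_rpow_neg_natCast (s := s) 2
  rw [G, h1, h5, h5', h4, Real.rpow_two]
  field_simp
  ring

theorem Gu_eq_rpow {u : ℝ} (hu : 0 < u) (q d al : ℝ) :
    Gu u q d al = d * q * bC * (-5 / 2) * u ^ (-7 / 2 : ℝ) + bC * (1 / 2) * u ^ (-3 / 2 : ℝ)
      + -aC * 2 * u ^ (1 : ℝ) + d * q ^ 2 * 2 * u ^ (-3 : ℝ) + 0 := by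
  rw [Gu, deriv_eq_of_eqOn_pos hu (fun t ht => G_eq_rpow ht q d al)
    (hasDerivAt_four_rpow _ _ _ _ _ _ _ _ _ hu)]
  norm_num

theorem Guu_eq_rpow {u : ℝ} (hu : 0 < u) (q d al : ℝ) :
    Guu u q d al = d * q * bC * (35 / 4) * u ^ (-9 / 2 : ℝ) + -bC * (3 / 4) * u ^ (-5 / 2 : ℝ)
      + -aC * 2 * u ^ (0 : ℝ) + -(d * q ^ 2) * 6 * u ^ (-4 : ℝ) + 0 := by
  rw [Guu, deriv_eq_of_eqOn_pos hu (fun t ht => Gu_eq_rpow ht q d al)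
    (hasDerivAt_four_rpow _ _ _ _ _ _ _ _ _ hu)]
  norm_num
  ring

theorem Guuu_eq_rpow {u : ℝ} (hu : 0 < u) (q d al : ℝ) :
    Guuu u q d al = d * q * bC * (-315 / 8) * u ^ (-11 / 2 : ℝ) + bC * (15 / 8) * u ^ (-7 / 2 : ℝ)
      + d * q ^ 2 * 24 * u ^ (-5 : ℝ) := by
  rw [Guuu, deriv_eq_of_eqOn_pos hu (fun t ht => Guu_eq_rpow ht q d al)
    (hasDerivAt_four_rpow _ _ _ _ _ _ _ _ _ hu)]
  norm_num
  ring

/-- Derivative of a quadratic polynomial. -/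
theorem hasDerivAt_quadratic (A B C q : ℝ) :
    HasDerivAt (fun t : ℝ => A * t ^ 2 + B * t + C) (2 * A * q + B) q := by
  refine ((((hasDerivAt_pow 2 q).const_mul A).add ((hasDerivAt_id q).const_mul B)).add_const
    C).congr_deriv ?_
  norm_num
  ring

theorem Gq_eq_rpow {u : ℝ} (hu : 0 < u) (q d al : ℝ) :
    Gq u q d al = 2 * (-d * u ^ (-2 : ℝ)) * q + (d * bC * u ^ (-5 / 2 : ℝ) + aC * d + 1) := by
  rw [Gq]
  refine ((hasDerivAt_quadratic (-d * u ^ (-2 : ℝ)) (d * bC * u ^ (-5 / 2 : ℝ) + aC * d + 1)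
    (-bC * u ^ (-1 / 2 : ℝ) + -aC * u ^ (2 : ℝ) + al) q).congr_of_eventuallyEq
    (.of_forall fun t => ?_)).deriv
  beta_reduce
  rw [G_eq_rpow hu]
  ring

theorem Guq_eq_rpow {u : ℝ} (hu : 0 < u) (q d al : ℝ) :
    Guq u q d al = 2 * (2 * d * u ^ (-3 : ℝ)) * q + d * bC * (-5 / 2) * u ^ (-7 / 2 : ℝ) := by
  rw [Guq]
  refine ((hasDerivAt_quadratic (2 * d * u ^ (-3 : ℝ)) (d * bC * (-5 / 2) * u ^ (-7 / 2 : ℝ))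
    (bC * (1 / 2) * u ^ (-3 / 2 : ℝ) + -aC * 2 * u ^ (1 : ℝ)) q).congr_of_eventuallyEq
    (.of_forall fun t => ?_)).deriv
  beta_reduce
  rw [Gu_eq_rpow hu]
  ring

theorem rpow_five_halves_E2 :
    (bC ^ ((2:ℝ)/5) / (2 * (2:ℝ) ^ ((1:ℝ)/5) * aC ^ ((2:ℝ)/5))) ^ ((5:ℝ)/2) = bC / (8 * aC) := by
  have ha : 0 ≤ aC := by norm_num [aC]
  have hb : 0 ≤ bC := by norm_num [bC]
  have h2 : (2 : ℝ) * 2 ^ ((1:ℝ)/5) = 2 ^ ((6:ℝ)/5) := by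
    rw [← Real.rpow_one_add' (by norm_num) (by norm_num)]
    norm_num
  rw [h2, Real.div_rpow (by positivity) (by positivity), Real.mul_rpow (by positivity)
    (by positivity), ← Real.rpow_mul hb, ← Real.rpow_mul ha, ← Real.rpow_mul (by norm_num)]
  norm_num

/-- The unique `E₂` point of the L–H problem, where two hysteresis points meet
(épée à épée). -/
theorem LH_E2_point (us qs ds als : ℝ)
    (hu : us = bC ^ ((2:ℝ)/5) / (2 * (2:ℝ) ^ ((1:ℝ)/5) * aC ^ ((2:ℝ)/5)))
    (hq : qs = 5*bC / (8 * Real.sqrt us))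
    (hd : ds = 8 * us ^ ((5:ℝ)/2) / (25*bC))
    (hal : als = 2*bC / (5 * Real.sqrt us)) :
    G us qs ds als = 0 ∧ Gu us qs ds als = 0 ∧
    Guq us qs ds als = 0 ∧ Guu us qs ds als = 0 ∧
    Gq us qs ds als = 24/25 ∧ Gq us qs ds als > 0 ∧
    Guuu us qs ds als = -(3*bC) / us ^ ((7:ℝ)/2) ∧ Guuu us qs ds als < 0 := by
  have hb : 0 < bC := by norm_num [bC]
  have ha : 0 < aC := by norm_num [aC]
  have hu0 : 0 < us := by rw [hu]; positivity
  have hW : us ^ ((5:ℝ)/2) = bC / (8 * aC) := by rw [hu, rpow_five_halves_E2]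
  clear hu
  obtain ⟨s, hs, rfl⟩ : ∃ s : ℝ, 0 < s ∧ us = s ^ 2 :=
    ⟨√us, Real.sqrt_pos.2 hu0, (Real.sq_sqrt hu0.le).symm⟩
  rw [Real.sqrt_sq hs.le] at hq hal
  have h1 : (s ^ 2) ^ (-1 / 2 : ℝ) = s⁻¹ := by
    simpa using sq_rpow_neg_natCast_div_two hs 1
  have h3 : (s ^ 2) ^ (-3 / 2 : ℝ) = (s ^ 3)⁻¹ := mod_cast sq_rpow_neg_natCast_div_two hs 3
  have h5 : (s ^ 2) ^ (-5 / 2 : ℝ) = (s ^ 5)⁻¹ := mod_cast sq_rpow_neg_natCast_div_two hs 5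
  have h7 : (s ^ 2) ^ (-7 / 2 : ℝ) = (s ^ 7)⁻¹ := mod_cast sq_rpow_neg_natCast_div_two hs 7
  have h9 : (s ^ 2) ^ (-9 / 2 : ℝ) = (s ^ 9)⁻¹ := mod_cast sq_rpow_neg_natCast_div_two hs 9
  have h11 : (s ^ 2) ^ (-11 / 2 : ℝ) = (s ^ 11)⁻¹ := mod_cast sq_rpow_neg_natCast_div_two hs 11
  have h4 : (s ^ 2) ^ (-2 : ℝ) = (s ^ 4)⁻¹ := mod_cast sq_rpow_neg_natCast (s := s) 2
  have h6 : (s ^ 2) ^ (-3 : ℝ) = (s ^ 6)⁻¹ := mod_cast sq_rpow_neg_natCast (s := s) 3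
  have h8 : (s ^ 2) ^ (-4 : ℝ) = (s ^ 8)⁻¹ := mod_cast sq_rpow_neg_natCast (s := s) 4
  have h10 : (s ^ 2) ^ (-5 : ℝ) = (s ^ 10)⁻¹ := mod_cast sq_rpow_neg_natCast (s := s) 5
  have p5 : (s ^ 2) ^ (5 / 2 : ℝ) = s ^ 5 := mod_cast sq_rpow_natCast_div_two hs 5
  have p7 : (s ^ 2) ^ (7 / 2 : ℝ) = s ^ 7 := mod_cast sq_rpow_natCast_div_two hs 7
  rw [p5] at hd hW
  have ha' : aC = bC / (8 * s ^ 5) := by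
    rw [hW]
    field_simp
  have hGq : Gq (s ^ 2) qs ds als = 24 / 25 := by
    rw [Gq_eq_rpow hu0, h4, h5, hd, hq, ha']
    field_simp
    ring
  have hGuuu : Guuu (s ^ 2) qs ds als = -(3 * bC) / (s ^ 2) ^ ((7 : ℝ) / 2) := by
    rw [Guuu_eq_rpow hu0, h11, h7, h10, p7, hd, hq]
    field_simp
    ring
  refine ⟨?_, ?_, ?_, ?_, hGq, ?_, hGuuu, ?_⟩
  · rw [G_eq_rpow hu0, h5, h1, h4, Real.rpow_two, hal, hd, hq, ha']
    field_simp
    ring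
  · rw [Gu_eq_rpow hu0, h7, h3, h6, Real.rpow_one, hd, hq, ha']
    field_simp
    ring
  · rw [Guq_eq_rpow hu0, h6, h7, hd, hq]
    field_simp
    ring
  · rw [Guu_eq_rpow hu0, h9, h5, h8, Real.rpow_zero, hd, hq, ha']
    field_simp
    ring
  · rw [hGq]
    norm_num
  · rw [hGuuu, neg_div]
    exact neg_neg_of_pos (by positivity)
end
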